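/- Let g ∈ A_k have Garside normal form g = g₁⋯g_m·Δ^δ with −m < δ < 0, and let L ⊆ {1,…,m} be a set of |δ| indices such that (gᵢ)_{i∈L} are elements of maximal possible length among g₁,…,g_m. Then |g|_S = Σ_{i∈L}(k − |gᵢ|_S) + Σ_{i∉L}|gᵢ|_S. -/

import Mathlib

/-- The alternating word `xyxy⋯` with `n` letters in the free group on `Bool`. -/
def altWord : Bool → ℕ → FreeGroup Bool
  | _, 0 => 1
  | x, n + 1 => FreeGroup.of x * altWord (!x) n

/-- The Artin relation `prod(a,b;k) = prod(b,a;k)`. -/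
def artinRel (k : ℕ) : Set (FreeGroup Bool) := {altWord false k * (altWord true k)⁻¹}

/-- The Artin group of dihedral type `A_k = ⟨a, b ∣ prod(a,b;k) = prod(b,a;k)⟩`. -/
def Ak (k : ℕ) : Type := PresentedGroup (artinRel k)

instance (k : ℕ) : Group (Ak k) := inferInstanceAs (Group (PresentedGroup (artinRel k)))

/-- The generator `a` of `A_k`. -/
def aA (k : ℕ) : Ak k := PresentedGroup.of false

/-- The generator `b` of `A_k`. -/
def bA (k : ℕ) : Ak k := PresentedGroup.of true

/-- `altProd x y n = prod(x,y;n) = xyxy⋯` with `n` factors. -/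
def altProd {G : Type*} [Monoid G] : G → G → ℕ → G
  | _, _, 0 => 1
  | x, y, n + 1 => x * altProd y x n

/-- The Garside element `Δ = prod(a,b;k)` of `A_k`. -/
def ΔA (k : ℕ) : Ak k := altProd (aA k) (bA k) k
/-- The set `S = {a, b, a⁻¹, b⁻¹}` of Artin generators of `A_k`. -/
def Sset (k : ℕ) : Set (Ak k) := {aA k, bA k, (aA k)⁻¹, (bA k)⁻¹}

/-- Word length on `A_k` with respect to `S = {a, b, a⁻¹, b⁻¹}`. -/
noncomputable def lenS (k : ℕ) (g : Ak k) : ℕ :=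
  sInf {n | ∃ L : List (Ak k), (∀ x ∈ L, x ∈ Sset k) ∧ L.length = n ∧ L.prod = g}

/-- The set `T = {prod(a,b;i), prod(b,a;i) : 1 ≤ i ≤ k-1}`. -/
def TsetA (k : ℕ) : Set (Ak k) :=
  {g | ∃ i, 1 ≤ i ∧ i ≤ k - 1 ∧
    (g = altProd (aA k) (bA k) i ∨ g = altProd (bA k) (aA k) i)}

namespace Dih

/-- Flip a letter `n` times. -/
def fl (n : ℕ) (s : Bool) : Bool := xor s n.bodd

/-- States: factors `(last letter, length)` from the last one to the first one, and the exponent. -/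
abbrev St := List (Bool × ℕ) × ℤ

/-- The letter seen before passing `Δ ^ δ`. -/
def rel (k : ℕ) (δ : ℤ) (s : Bool) : Bool := xor s (k.bodd && δ.bodd)

/-- Right multiplication by a generator on normal forms. -/
def F (k : ℕ) (s : Bool) : St → St
  | ([], δ) => ([(rel k δ s, 1)], δ)
  | ((e, l) :: Q, δ) =>
    if e = rel k δ s then ((rel k δ s, 1) :: (e, l) :: Q, δ)
    else if l + 1 = k then (Q, δ + 1)
    else ((rel k δ s, l + 1) :: Q, δ)

/-- The top factor (if any) ends in `s`. -/
def topOK (s : Bool) : List (Bool × ℕ) → Prop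
  | [] => True
  | p :: _ => p.1 = s

/-- Validity of normal forms. -/
def V (k : ℕ) : List (Bool × ℕ) → Prop
  | [] => True
  | p :: Q => 1 ≤ p.2 ∧ p.2 < k ∧ topOK (xor p.1 (!p.2.bodd)) Q ∧ V k Q

/-- Right multiplication by an alternating word. -/
def run (k : ℕ) : Bool → ℕ → St → St
  | _, 0, x => x
  | s, n + 1, x => run k (!s) n (F k s x)

theorem run_add (k : ℕ) (s : Bool) (m n : ℕ) (x : St) :
    run k s (m + n) x = run k (fl m s) n (run k s m x) := by
  induction m generalizing s x with
  | zero => simp [run, fl]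
  | succ m ih =>
    rw [Nat.add_right_comm]
    simp only [run, ih]
    congr 1
    simp [fl]

theorem F_V (k : ℕ) (hk : 3 ≤ k) (s : Bool) (x : St) (h : V k x.1) : V k (F k s x).1 := by
  rcases x with ⟨_ | ⟨⟨e, l⟩, Q⟩, δ⟩
  · simp [F, V, topOK]; omega
  · obtain ⟨h1, h2, h3, h4⟩ := h
    simp only at h1 h2 h3
    simp only [F]
    split_ifs with ha hb
    · refine ⟨le_rfl, by simp only; omega, ?_, h1, h2, h3, h4⟩
      simp [topOK, ha]
    · exact h4
    · refine ⟨by simp only; omega, by simp only; omega, ?_, h4⟩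
      have : rel k δ s = !e := by
        revert ha; cases e <;> cases rel k δ s <;> simp
      simp only [this, Nat.bodd_succ]
      convert h3 using 1
      cases e <;> cases l.bodd <;> rfl

theorem run_extend (k : ℕ) (Q : List (Bool × ℕ)) (δ : ℤ) (n : ℕ) (s e : Bool) (l : ℕ)
    (hs : rel k δ s = !e) (hl : l + n < k) :
    run k s n ((e, l) :: Q, δ) = ((fl n e, l + n) :: Q, δ) := by
  induction n generalizing s e l with
  | zero => simp [run, fl]
  | succ n ih =>
    have hne : e ≠ rel k δ s := by rw [hs]; cases e <;> simp
    have h2 : l + 1 ≠ k := by omega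
    simp only [run, F, if_neg hne, if_neg h2]
    rw [ih]
    · have h3 : fl n (rel k δ s) = fl (n + 1) e := by
        simp only [fl, hs, Nat.bodd_succ]; cases e <;> cases n.bodd <;> rfl
      rw [h3, Nat.add_assoc, Nat.add_comm 1 n]
    · simp [rel]
    · omega

theorem run_push (k : ℕ) (Q : List (Bool × ℕ)) (δ : ℤ) (n : ℕ) (s : Bool)
    (hQ : topOK (rel k δ s) Q) (hl : n + 1 < k) :
    run k s (n + 1) (Q, δ) = ((fl n (rel k δ s), n + 1) :: Q, δ) := by
  have h1 : F k s (Q, δ) = ((rel k δ s, 1) :: Q, δ) := by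
    rcases Q with _ | ⟨⟨e, l⟩, Q⟩
    · rfl
    · simp only [topOK] at hQ
      simp [F, hQ]
  simp only [run, h1]
  rw [run_extend]
  · rw [Nat.add_comm]
  · simp [rel]
  · omega

theorem run_pop (k : ℕ) (Q : List (Bool × ℕ)) (δ : ℤ) (s e : Bool)
    (hs : rel k δ s = !e) (hk : 3 ≤ k) :
    run k s 1 ((e, k - 1) :: Q, δ) = (Q, δ + 1) := by
  have hne : e ≠ rel k δ s := by rw [hs]; cases e <;> simp
  have h2 : k - 1 + 1 = k := by omega
  simp only [run, F, if_neg hne, if_pos h2]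

theorem run_full (k : ℕ) (hk : 3 ≤ k) (s : Bool) (x : St) (h : V k x.1) :
    run k s k x = (x.1, x.2 + 1) := by
  obtain ⟨Q, δ⟩ := x
  by_cases ht : topOK (rel k δ s) Q
  · obtain ⟨n, rfl⟩ : ∃ n, k = n + 1 + 1 := ⟨k - 2, by omega⟩
    rw [run_add, run_push _ _ _ _ _ ht (by omega)]
    have := run_pop (n + 1 + 1) Q δ (fl (n + 1) s) (fl n (rel (n + 1 + 1) δ s)) (by
      simp only [rel, fl, Nat.bodd_succ]
      cases s <;> cases n.bodd <;> cases δ.bodd <;> rfl) hk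
    simpa using this
  · rcases Q with _ | ⟨⟨e, l⟩, Q⟩
    · simp [topOK] at ht
    · have hs : rel k δ s = !e := by
        simp only [topOK] at ht
        revert ht; cases e <;> cases rel k δ s <;> simp
      obtain ⟨h1, h2, h3, h4⟩ := h
      simp only at h1 h2 h3
      obtain ⟨l, rfl⟩ : ∃ m, l = m + 1 := ⟨l - 1, by omega⟩
      obtain ⟨n, rfl⟩ : ∃ n, k = n + 1 + (l + 1) := ⟨k - 1 - (l + 1), by omega⟩
      rw [run_add _ _ (n + 1), run_add _ _ n, run_extend _ _ _ _ _ _ _ hs (by omega)]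
      have h5 : l + 1 + n = n + 1 + (l + 1) - 1 := by omega
      rw [h5, run_pop _ _ _ _ _ (by
        revert hs
        simp only [rel, fl, Nat.bodd_succ, Nat.bodd_add]
        generalize n.bodd = p
        generalize l.bodd = q
        generalize δ.bodd = r
        clear h3 ht
        revert s e p q r
        decide) hk]
      have h6 : rel (n + 1 + (l + 1)) (δ + 1) (fl (n + 1) s) = xor e (!(l + 1).bodd) := by
        revert hs
        simp only [rel, fl, Nat.bodd_succ, Nat.bodd_add, Int.bodd_add, Int.bodd_one]
        generalize n.bodd = p
        generalize l.bodd = q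
        generalize δ.bodd = r
        clear h3 ht
        revert s e p q r
        decide
      rw [run_push _ _ _ _ _ (by rw [h6]; exact h3) (by omega), h6]
      simp only [fl, Nat.bodd_succ]
      cases e <;> cases l.bodd <;> rfl

theorem run_V (k : ℕ) (hk : 3 ≤ k) (s : Bool) (n : ℕ) (x : St) (h : V k x.1) :
    V k (run k s n x).1 := by
  induction n generalizing s x with
  | zero => exact h
  | succ n ih => exact ih _ _ (F_V k hk s x h)

/-- Valid states. -/
abbrev VS (k : ℕ) := {x : St // V k x.1}

/-- Action of a generator on valid states. -/
def FV (k : ℕ) (hk : 3 ≤ k) (s : Bool) (x : VS k) : VS k := ⟨F k s x.1, F_V k hk s x.1 x.2⟩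

theorem FV_bij (k : ℕ) (hk : 3 ≤ k) (s : Bool) : Function.Bijective (FV k hk s) := by
  constructor
  · rintro ⟨x, hx⟩ ⟨y, hy⟩ h
    have h1 : F k s x = F k s y := congrArg Subtype.val h
    have hx' := run_full k hk s x hx
    have hy' := run_full k hk s y hy
    obtain ⟨n, rfl⟩ : ∃ n, k = n + 1 := ⟨k - 1, by omega⟩
    simp only [run] at hx' hy'
    rw [h1, hy'] at hx'
    apply Subtype.ext
    apply Prod.ext
    · exact (congrArg Prod.fst hx').symm
    · have := congrArg Prod.snd hx'
      simp only at this ⊢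
      linarith
  · rintro ⟨⟨Q, δ⟩, hy⟩
    have h := run_full k hk (fl (k - 1) s) (Q, δ - 1) hy
    obtain ⟨n, rfl⟩ : ∃ n, k = n + 1 := ⟨k - 1, by omega⟩
    rw [run_add] at h
    refine ⟨⟨run (n + 1) (fl n s) n (Q, δ - 1), run_V _ hk _ _ _ hy⟩, ?_⟩
    apply Subtype.ext
    simp only [FV]
    simp [run, fl] at h
    simpa [fl] using h

/-- The permutation of a generator. -/
noncomputable def FP (k : ℕ) (hk : 3 ≤ k) (s : Bool) : (Equiv.Perm (VS k))ᵐᵒᵖ :=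
  MulOpposite.op (Equiv.ofBijective _ (FV_bij k hk s))

theorem FP_alt (k : ℕ) (hk : 3 ≤ k) (s : Bool) (n : ℕ) (x : VS k) :
    ((MulOpposite.unop (FreeGroup.lift (FP k hk) (altWord s n))) x).1 = run k s n x.1 := by
  induction n generalizing s x with
  | zero => simp [altWord, run]
  | succ n ih =>
    simp only [altWord, map_mul, FreeGroup.lift_apply_of, MulOpposite.unop_mul,
      Equiv.Perm.mul_apply, ih, run]
    rfl

/-- The action homomorphism. -/
noncomputable def act (k : ℕ) (hk : 3 ≤ k) : Ak k →* (Equiv.Perm (VS k))ᵐᵒᵖ :=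
  PresentedGroup.toGroup (rels := artinRel k) (f := FP k hk) (by
    intro r hr
    rw [artinRel, Set.mem_singleton_iff] at hr
    rw [hr, map_mul, map_inv, mul_inv_eq_one]
    apply MulOpposite.unop_injective
    ext1 x
    apply Subtype.ext
    rw [FP_alt, FP_alt, run_full k hk _ _ x.2, run_full k hk _ _ x.2])

/-- The state reached from `x` by right multiplication by `g`. -/
noncomputable def ac (k : ℕ) (hk : 3 ≤ k) (x : VS k) (g : Ak k) : VS k :=
  (MulOpposite.unop (act k hk g)) x

theorem ac_mul (k : ℕ) (hk : 3 ≤ k) (x : VS k) (g h : Ak k) :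
    ac k hk x (g * h) = ac k hk (ac k hk x g) h := by
  simp [ac]

theorem ac_one (k : ℕ) (hk : 3 ≤ k) (x : VS k) : ac k hk x 1 = x := by
  simp [ac]

/-- Generators. -/
def gen (k : ℕ) (s : Bool) : Ak k := PresentedGroup.of s

theorem ac_gen (k : ℕ) (hk : 3 ≤ k) (x : VS k) (s : Bool) :
    (ac k hk x (gen k s)).1 = F k s x.1 := by
  have : act k hk (gen k s) = FP k hk s := PresentedGroup.toGroup.of _
  simp only [ac, this]
  rfl

/-- Alternating products. -/
def ap (k : ℕ) : Bool → ℕ → Ak k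
  | _, 0 => 1
  | s, n + 1 => gen k s * ap k (!s) n

theorem ac_ap (k : ℕ) (hk : 3 ≤ k) (s : Bool) (n : ℕ) (x : VS k) :
    (ac k hk x (ap k s n)).1 = run k s n x.1 := by
  induction n generalizing s x with
  | zero => simp [ap, run, ac_one]
  | succ n ih => simp only [ap, ac_mul, ih, run, ac_gen]

theorem ap_eq (k : ℕ) (s : Bool) (n : ℕ) : ap k s n = altProd (gen k s) (gen k (!s)) n := by
  induction n generalizing s with
  | zero => rfl
  | succ n ih => simp [ap, altProd, ih]

theorem ap_mk (k : ℕ) (s : Bool) (n : ℕ) :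
    ap k s n = PresentedGroup.mk (artinRel k) (altWord s n) := by
  induction n generalizing s with
  | zero => simp only [ap, altWord, map_one]; rfl
  | succ n ih => simp only [ap, altWord, map_mul, ih]; rfl

theorem ap_full (k : ℕ) (s : Bool) : ap k s k = ΔA k := by
  have h0 : ap k false k = ΔA k := ap_eq k false k
  have h1 : ap k true k = ap k false k := by
    rw [ap_mk, ap_mk]
    symm
    apply PresentedGroup.mk_eq_mk_of_mul_inv_mem
    exact rfl
  cases s
  · exact h0
  · rw [h1, h0]

theorem ap_add (k : ℕ) (s : Bool) (m n : ℕ) :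
    ap k s (m + n) = ap k s m * ap k (fl m s) n := by
  induction m generalizing s with
  | zero => simp [ap, fl]
  | succ m ih =>
    rw [Nat.add_right_comm]
    simp only [ap, ih, mul_assoc]
    congr 3
    simp [fl]

theorem D_ap (k : ℕ) (s : Bool) (n : ℕ) : ΔA k * ap k s n = ap k (fl k s) n * ΔA k := by
  rw [← ap_full k (fl n (fl k s)), ← ap_add, Nat.add_comm n k, ap_add, ap_full, ap_full]
  congr 2
  simp [fl]

theorem ac_D (k : ℕ) (hk : 3 ≤ k) (x : VS k) :
    (ac k hk x (ΔA k)).1 = (x.1.1, x.1.2 + 1) := by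
  rw [← ap_full k false, ac_ap, run_full k hk _ _ x.2]

theorem ac_Dz (k : ℕ) (hk : 3 ≤ k) (x : VS k) (δ : ℤ) :
    (ac k hk x (ΔA k ^ δ)).1 = (x.1.1, x.1.2 + δ) := by
  induction δ using Int.induction_on with
  | zero => simp [ac_one]
  | succ n ih =>
    rw [zpow_add_one, ac_mul, ac_D, ih]; simp [add_assoc]
  | pred n ih =>
    have h := ac_D k hk (ac k hk x (ΔA k ^ (-(n:ℤ) - 1)))
    rw [← ac_mul, ← zpow_add_one, sub_add_cancel, ih] at h
    apply Prod.ext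
    · exact (congrArg Prod.fst h).symm
    · have := congrArg Prod.snd h
      simp only at this ⊢
      linarith

/-- The cost function. -/
def cst (k : ℕ) : List (Bool × ℕ) → ℤ → ℤ
  | [], δ => k * |δ|
  | p :: Q, δ => min (p.2 + cst k Q δ) (k - p.2 + cst k Q (δ + 1))

theorem cst_lip (k : ℕ) (Q : List (Bool × ℕ)) (δ : ℤ) :
    cst k Q (δ + 1) ≤ cst k Q δ + k ∧ cst k Q δ ≤ cst k Q (δ + 1) + k := by
  induction Q generalizing δ with
  | nil =>
    simp only [cst]
    have h1 : |δ + 1| ≤ |δ| + 1 := by grind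
    have h2 : |δ| ≤ |δ + 1| + 1 := by grind
    have h0 : (0 : ℤ) ≤ k := by positivity
    constructor <;> nlinarith
  | cons p Q ih =>
    have h1 := ih δ
    have h2 := ih (δ + 1)
    simp only [cst]
    omega

theorem cst_F (k : ℕ) (hk : 3 ≤ k) (s : Bool) (x : St) (hx : V k x.1) :
    cst k (F k s x).1 (F k s x).2 ≤ cst k x.1 x.2 + 1 ∧
    cst k x.1 x.2 ≤ cst k (F k s x).1 (F k s x).2 + 1 := by
  obtain ⟨Q, δ⟩ := x
  have push : ∀ (e : Bool) (Q : List (Bool × ℕ)), cst k ((e, 1) :: Q) δ ≤ cst k Q δ + 1 ∧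
      cst k Q δ ≤ cst k ((e, 1) :: Q) δ + 1 := by
    intro e Q
    have := cst_lip k Q δ
    simp only [cst]
    push_cast
    omega
  rcases Q with _ | ⟨⟨e, l⟩, Q⟩
  · exact push _ _
  · simp only [F]
    split_ifs with ha hb
    · exact push _ _
    · have := cst_lip k Q δ
      simp only [cst]
      subst hb
      push_cast at *
      omega
    · simp only [cst]
      push_cast
      omega

theorem cst_ac_gen (k : ℕ) (hk : 3 ≤ k) (x : VS k) (s : Ak k) (hs : s ∈ Sset k) :
    cst k (ac k hk x s).1.1 (ac k hk x s).1.2 ≤ cst k x.1.1 x.1.2 + 1 := by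
  have pos : ∀ b, cst k (ac k hk x (gen k b)).1.1 (ac k hk x (gen k b)).1.2
      ≤ cst k x.1.1 x.1.2 + 1 := by
    intro b
    rw [ac_gen]
    exact (cst_F k hk b x.1 x.2).1
  have neg : ∀ b, cst k (ac k hk x (gen k b)⁻¹).1.1 (ac k hk x (gen k b)⁻¹).1.2
      ≤ cst k x.1.1 x.1.2 + 1 := by
    intro b
    have h := (cst_F k hk b (ac k hk x (gen k b)⁻¹).1 (ac k hk x (gen k b)⁻¹).2).2
    rw [← ac_gen k hk, ← ac_mul, inv_mul_cancel, ac_one] at h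
    exact h
  rcases hs with rfl | rfl | rfl | rfl
  · exact pos false
  · exact pos true
  · exact neg false
  · exact neg true

theorem cst_list (k : ℕ) (hk : 3 ≤ k) (M : List (Ak k)) (hM : ∀ y ∈ M, y ∈ Sset k) (x : VS k) :
    cst k (ac k hk x M.prod).1.1 (ac k hk x M.prod).1.2 ≤ cst k x.1.1 x.1.2 + M.length := by
  induction M generalizing x with
  | nil => simp [ac_one]
  | cons y M ih =>
    rw [List.prod_cons, ac_mul]
    have h1 := ih (fun z hz => hM z (List.mem_cons_of_mem _ hz)) (ac k hk x y)
    have h2 := cst_ac_gen k hk x y (hM y List.mem_cons_self)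
    rw [List.length_cons]
    push_cast
    omega

/-- Base state. -/
def base (k : ℕ) : VS k := ⟨([], 0), trivial⟩

/-- `g` is a product of `n` elements of `S`. -/
def Rep (k : ℕ) (g : Ak k) (n : ℕ) : Prop :=
  ∃ L : List (Ak k), (∀ x ∈ L, x ∈ Sset k) ∧ L.length = n ∧ L.prod = g

theorem len_le (k : ℕ) (g : Ak k) (n : ℕ) (h : Rep k g n) : lenS k g ≤ n :=
  Nat.sInf_le h

theorem le_len (k : ℕ) (hk : 3 ≤ k) (g : Ak k) (n : ℕ) (h : Rep k g n) :
    cst k (ac k hk (base k) g).1.1 (ac k hk (base k) g).1.2 ≤ lenS k g := by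
  obtain ⟨M, hM, h1, h2⟩ : Rep k g (lenS k g) :=
    Nat.sInf_mem (s := {n | Rep k g n}) ⟨n, h⟩
  have := cst_list k hk M hM (base k)
  rw [h2, h1] at this
  simpa [base, cst] using this

theorem cst_dual (k : ℕ) (τ : ℤ) (h0 : 0 ≤ τ) (h1 : τ ≤ k) (Q : List (Bool × ℕ)) (δ : ℤ) :
    (2 * τ - k) * δ + (Q.map fun p => min (p.2 : ℤ) (2 * τ - p.2)).sum ≤ cst k Q δ := by
  induction Q generalizing δ with
  | nil =>
    simp only [cst, List.map_nil, List.sum_nil, add_zero]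
    have h : |2 * τ - k| ≤ k := by rw [abs_le]; constructor <;> linarith
    calc (2 * τ - k) * δ ≤ |(2 * τ - k) * δ| := le_abs_self _
      _ = |2 * τ - k| * |δ| := abs_mul _ _
      _ ≤ k * |δ| := by gcongr
  | cons p Q ih =>
    have h2 := ih δ
    have h3 := ih (δ + 1)
    simp only [cst, List.map_cons, List.sum_cons]
    rw [mul_add] at h3
    omega

theorem Rep_mul (k : ℕ) (g h : Ak k) (m n : ℕ) (hg : Rep k g m) (hh : Rep k h n) :
    Rep k (g * h) (m + n) := by
  obtain ⟨A, a1, rfl, rfl⟩ := hg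
  obtain ⟨B, b1, rfl, rfl⟩ := hh
  refine ⟨A ++ B, ?_, by simp, by simp⟩
  intro x hx
  rcases List.mem_append.1 hx with h | h
  · exact a1 x h
  · exact b1 x h

theorem gen_mem (k : ℕ) (s : Bool) : gen k s ∈ Sset k := by
  cases s
  · exact Or.inl rfl
  · exact Or.inr (Or.inl rfl)

theorem gen_inv_mem (k : ℕ) (s : Bool) : (gen k s)⁻¹ ∈ Sset k := by
  cases s
  · exact Or.inr (Or.inr (Or.inl rfl))
  · exact Or.inr (Or.inr (Or.inr rfl))

theorem mem_Sset (k : ℕ) (x : Ak k) (h : x ∈ Sset k) :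
    ∃ s, x = gen k s ∨ x = (gen k s)⁻¹ := by
  rcases h with rfl | rfl | rfl | rfl
  · exact ⟨false, Or.inl rfl⟩
  · exact ⟨true, Or.inl rfl⟩
  · exact ⟨false, Or.inr rfl⟩
  · exact ⟨true, Or.inr rfl⟩

theorem Rep_single (k : ℕ) (x : Ak k) (h : x ∈ Sset k) : Rep k x 1 :=
  ⟨[x], by simpa using h, rfl, by simp⟩

theorem Rep_one (k : ℕ) : Rep k 1 0 := ⟨[], by simp, rfl, rfl⟩

theorem Rep_ap (k : ℕ) (s : Bool) (n : ℕ) : Rep k (ap k s n) n := by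
  induction n generalizing s with
  | zero => exact Rep_one k
  | succ n ih =>
    have := Rep_mul _ _ _ _ _ (Rep_single _ _ (gen_mem k s)) (ih (!s))
    rwa [Nat.add_comm] at this

theorem Rep_ap_inv (k : ℕ) (s : Bool) (n : ℕ) : Rep k (ap k s n)⁻¹ n := by
  induction n generalizing s with
  | zero => simpa [ap] using Rep_one k
  | succ n ih =>
    simp only [ap, mul_inv_rev]
    exact Rep_mul _ _ _ _ _ (ih _) (Rep_single _ _ (gen_inv_mem k s))

/-- `x Δ⁻¹` has length at most `k - n`. -/
theorem Rep_neg (k : ℕ) (s : Bool) (n : ℕ) (hn : n ≤ k) :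
    Rep k (ap k s n * (ΔA k)⁻¹) (k - n) := by
  obtain ⟨m, rfl⟩ := Nat.exists_eq_add_of_le hn
  have h : ap (n + m) s n * (ΔA (n + m))⁻¹ = (ap (n + m) (fl m s) m)⁻¹ := by
    have h2 : ΔA (n + m) = ap (n + m) (fl m s) m * ap (n + m) s n := by
      have h3 : s = fl m (fl m s) := by simp [fl]
      have h4 := ap_add (n + m) (fl m s) m n
      rw [← h3, Nat.add_comm m n, ap_full] at h4
      exact h4
    rw [h2]
    group
  rw [h]
  simpa using Rep_ap_inv _ _ m

/-- The element of `T` with given first letter and length. -/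
def el (k : ℕ) (p : Bool × ℕ) : Ak k := ap k p.1 p.2

/-- The last letter. -/
def lst (p : Bool × ℕ) : Bool := xor p.1 (!p.2.bodd)

theorem mem_T (k : ℕ) (x : Ak k) (h : x ∈ TsetA k) :
    ∃ p : Bool × ℕ, (1 ≤ p.2 ∧ p.2 < k) ∧ x = el k p := by
  obtain ⟨i, h1, h2, h | h⟩ := h
  · exact ⟨(false, i), ⟨h1, by simp only; omega⟩, by rw [h, el, ap_eq]; rfl⟩
  · exact ⟨(true, i), ⟨h1, by simp only; omega⟩, by rw [h, el, ap_eq]; rfl⟩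

theorem el_mem (k : ℕ) (p : Bool × ℕ) (h1 : 1 ≤ p.2) (h2 : p.2 < k) : el k p ∈ TsetA k := by
  obtain ⟨s, i⟩ := p
  refine ⟨i, h1, by simp only at h2; omega, ?_⟩
  cases s
  · left; rw [el, ap_eq]; rfl
  · right; rw [el, ap_eq]; rfl

theorem exists_list (k : ℕ) (L : List (Ak k)) (hT : ∀ x ∈ L, x ∈ TsetA k) :
    ∃ P : List (Bool × ℕ), (∀ p ∈ P, 1 ≤ p.2 ∧ p.2 < k) ∧ L = P.map (el k) := by
  induction L with
  | nil => exact ⟨[], by simp, rfl⟩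
  | cons x L ih =>
    obtain ⟨P, h1, rfl⟩ := ih (fun y hy => hT y (List.mem_cons_of_mem _ hy))
    obtain ⟨p, h2, rfl⟩ := mem_T k x (hT x List.mem_cons_self)
    refine ⟨p :: P, ?_, rfl⟩
    intro q hq
    rcases List.mem_cons.1 hq with rfl | h
    · exact h2
    · exact h1 q h

theorem D_gen (k : ℕ) (s : Bool) : ΔA k * gen k s * (ΔA k)⁻¹ = gen k (fl k s) := by
  have := D_ap k s 1
  simp only [ap, mul_one] at this
  rw [this]; group

theorem Rep_conj (k : ℕ) (g : Ak k) (n : ℕ) (h : Rep k g n) :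
    Rep k (ΔA k * g * (ΔA k)⁻¹) n := by
  obtain ⟨M, h1, rfl, rfl⟩ := h
  refine ⟨M.map (MulAut.conj (ΔA k)), ?_, by simp, ?_⟩
  · intro x hx
    obtain ⟨y, hy, rfl⟩ := List.mem_map.1 hx
    obtain ⟨s, rfl | rfl⟩ := mem_Sset k y (h1 y hy)
    · rw [MulAut.conj_apply, D_gen]; exact gen_mem _ _
    · rw [map_inv, MulAut.conj_apply, D_gen]; exact gen_inv_mem _ _
  · rw [← map_list_prod, MulAut.conj_apply]

theorem upper (k : ℕ) (P : List (Bool × ℕ)) (hP : ∀ p ∈ P, 1 ≤ p.2 ∧ p.2 < k) (f : ℕ → Bool) :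
    Rep k ((P.map (el k)).prod *
        ΔA k ^ (-(∑ i ∈ Finset.range P.length, if f i then (1 : ℤ) else 0)))
      (∑ i ∈ Finset.range P.length,
        if f i then k - (P.getD i (false, 0)).2 else (P.getD i (false, 0)).2) := by
  induction P generalizing f with
  | nil => simpa using Rep_one k
  | cons p P ih =>
    have h := ih (fun q hq => hP q (List.mem_cons_of_mem _ hq)) (fun i => f (i + 1))
    have hp := hP p List.mem_cons_self
    simp only [List.length_cons, Finset.sum_range_succ', List.map_cons, List.prod_cons,
      List.getD_cons_succ, List.getD_cons_zero]
    generalize (∑ i ∈ Finset.range P.length, if f (i + 1) then (1 : ℤ) else 0) = c at *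
    rw [Nat.add_comm (Finset.sum _ _)]
    by_cases hf : f 0 = true
    · simp only [hf, if_true]
      have h2 := Rep_mul _ _ _ _ _ (Rep_neg k p.1 p.2 hp.2.le) (Rep_conj _ _ _ h)
      convert h2 using 1
      rw [neg_add, zpow_add, el, zpow_neg_one]
      group
    · simp only [hf]
      have h2 := Rep_mul _ _ _ _ _ (Rep_ap k p.1 p.2) h
      convert h2 using 1
      · simp [el, mul_assoc]
      · simp

theorem run_nf (k : ℕ) (hk : 3 ≤ k) (P : List (Bool × ℕ)) (hP : ∀ p ∈ P, 1 ≤ p.2 ∧ p.2 < k)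
    (hc : P.IsChain (fun p q => lst p = q.1)) (x : VS k) (hx : x.1.2 = 0)
    (ht : ∀ p ∈ P.head?, topOK p.1 x.1.1) :
    (ac k hk x (P.map (el k)).prod).1 =
      ((P.map (fun p => (lst p, p.2))).reverse ++ x.1.1, 0) := by
  induction P generalizing x with
  | nil => simp [ac_one, ← hx]
  | cons p P ih =>
    have hp := hP p List.mem_cons_self
    have h1 : (ac k hk x (el k p)).1 = ((lst p, p.2) :: x.1.1, 0) := by
      obtain ⟨s, n⟩ := p
      obtain ⟨n, rfl⟩ : ∃ m, n = m + 1 := ⟨n - 1, by simp only at hp; omega⟩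
      have hx' : x.1 = (x.1.1, 0) := by rw [← hx]
      have hr : rel k 0 s = s := by simp [rel]
      rw [el, ac_ap, hx', run_push _ _ _ _ _ (by rw [hr]; exact ht (s, n + 1) (by simp)) hp.2, hr]
      simp [lst, fl]
    rw [List.map_cons, List.prod_cons, ac_mul, ih (fun q hq => hP q (List.mem_cons_of_mem _ hq))
      hc.tail _ (by rw [h1]) ?_, h1]
    · simp
    · intro q hq
      rw [h1]
      rcases P with _ | ⟨q', P⟩
      · simp at hq
      · simp only [List.head?_cons, Option.mem_def, Option.some.injEq] at hq
        subst hq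
        exact (List.isChain_cons_cons.1 hc).1

theorem len_el (k : ℕ) (hk : 3 ≤ k) (p : Bool × ℕ) (hp : 1 ≤ p.2 ∧ p.2 < k) :
    lenS k (el k p) = p.2 := by
  have hu : lenS k (el k p) ≤ p.2 := len_le _ _ _ (Rep_ap k p.1 p.2)
  apply le_antisymm hu
  have h := le_len k hk (el k p) p.2 (Rep_ap k p.1 p.2)
  have h2 := run_nf k hk [p] (by simpa using hp) (by simp) (base k) rfl (by simp [base, topOK])
  simp only [List.map_cons, List.map_nil, List.prod_cons, List.prod_nil, mul_one] at h2
  rw [h2] at h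
  simp only [base, List.reverse_cons, List.reverse_nil, List.nil_append, List.append_nil, cst,
    zero_add, abs_zero, mul_zero, add_zero, abs_one, mul_one] at h
  omega

theorem D_list (k : ℕ) (M : List (Ak k)) (hM : ∀ x ∈ M, x ∈ TsetA k) :
    ∃ M' : List (Ak k), (∀ x ∈ M', x ∈ TsetA k) ∧ M'.length = M.length ∧
      ΔA k * M.prod = M'.prod * ΔA k := by
  refine ⟨M.map (MulAut.conj (ΔA k)), ?_, by simp, ?_⟩
  · intro x hx
    obtain ⟨y, hy, rfl⟩ := List.mem_map.1 hx
    obtain ⟨p, hp, rfl⟩ := mem_T k y (hM y hy)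
    have : MulAut.conj (ΔA k) (el k p) = el k (fl k p.1, p.2) := by
      rw [MulAut.conj_apply, el, D_ap, el]; group
    rw [this]
    exact el_mem k _ hp.1 hp.2
  · rw [← map_list_prod, MulAut.conj_apply]; group

theorem merge (k : ℕ) (s : Bool) (q : ℕ) (hq : q < 2 * k) :
    ∃ (M : List (Ak k)) (ε : ℤ), (∀ x ∈ M, x ∈ TsetA k) ∧ M.length ≤ 1 ∧
      (ap k s q = M.prod * ΔA k ^ ε) ∧ (ε = 0 ∨ ε = 1) := by
  rcases Nat.eq_zero_or_pos q with rfl | h0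
  · exact ⟨[], 0, by simp, by simp, by simp [ap], Or.inl rfl⟩
  rcases lt_trichotomy q k with h | h | h
  · refine ⟨[el k (s, q)], 0, ?_, by simp, by simp [el], Or.inl rfl⟩
    intro x hx
    rw [List.mem_singleton.1 hx]
    exact el_mem k _ h0 h
  · exact ⟨[], 1, by simp, by simp, by simp [h, ap_full], Or.inr rfl⟩
  · refine ⟨[el k (s, q - k)], 1, ?_, by simp, ?_, Or.inr rfl⟩
    · intro x hx
      rw [List.mem_singleton.1 hx]
      exact el_mem k _ (by simp only; omega) (by simp only; omega)
    · have : q = q - k + k := by omega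
      conv_lhs => rw [this]
      rw [ap_add, ap_full]
      simp [el]

theorem chain_of_min (k : ℕ) (hk : 3 ≤ k) (P : List (Bool × ℕ))
    (hP : ∀ p ∈ P, 1 ≤ p.2 ∧ p.2 < k) (g : Ak k) (δ : ℤ)
    (hg : g = (P.map (el k)).prod * ΔA k ^ δ)
    (hmin : ∀ (L' : List (Ak k)) (δ' : ℤ), (∀ x ∈ L', x ∈ TsetA k) →
      g = L'.prod * ΔA k ^ δ' → P.length ≤ L'.length) :
    P.IsChain (fun p q => lst p = q.1) := by
  rw [List.isChain_iff_forall_rel_of_append_cons_cons]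
  intro p q A B hAB
  by_contra hne
  have hp := hP p (by simp [hAB])
  have hq := hP q (by simp [hAB])
  have hTA : ∀ x ∈ A.map (el k), x ∈ TsetA k := by
    intro x hx
    obtain ⟨y, hy, rfl⟩ := List.mem_map.1 hx
    have := hP y (by simp [hAB, hy])
    exact el_mem k _ this.1 this.2
  have hTB : ∀ x ∈ B.map (el k), x ∈ TsetA k := by
    intro x hx
    obtain ⟨y, hy, rfl⟩ := List.mem_map.1 hx
    have := hP y (by simp [hAB, hy])
    exact el_mem k _ this.1 this.2
  have hfl : q.1 = fl p.2 p.1 := by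
    revert hne
    simp only [lst, fl]
    cases p.1 <;> cases q.1 <;> cases p.2.bodd <;> simp
  have hpq : el k p * el k q = ap k p.1 (p.2 + q.2) := by
    rw [ap_add, ← hfl, el, el]
  obtain ⟨M, ε, hM, hM1, hM2, hε⟩ := merge k p.1 (p.2 + q.2) (by omega)
  obtain ⟨B', hB', hBl, hBp⟩ : ∃ B' : List (Ak k), (∀ x ∈ B', x ∈ TsetA k) ∧
      B'.length = B.length ∧ ΔA k ^ ε * (B.map (el k)).prod = B'.prod * ΔA k ^ ε := by
    rcases hε with rfl | rfl
    · exact ⟨B.map (el k), hTB, by simp, by simp⟩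
    · obtain ⟨B', h1, h2, h3⟩ := D_list k _ hTB
      exact ⟨B', h1, by simpa using h2, by simpa using h3⟩
  have := hmin (A.map (el k) ++ M ++ B') (ε + δ) (by
    intro x hx
    rcases List.mem_append.1 hx with hx | hx
    · rcases List.mem_append.1 hx with hx | hx
      · exact hTA x hx
      · exact hM x hx
    · exact hB' x hx) (by
    rw [hg, hAB]
    simp only [List.map_append, List.map_cons, List.prod_append, List.prod_cons]
    rw [← mul_assoc (el k p), hpq, hM2, mul_assoc M.prod, hBp, zpow_add]
    simp only [mul_assoc])
  rw [hAB] at this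
  simp only [List.length_append, List.length_cons, List.length_map, hBl] at this
  omega

theorem sum_getD (P : List (Bool × ℕ)) (h : ℕ → ℤ) :
    (P.map fun p => h p.2).sum = ∑ i ∈ Finset.range P.length, h (P.getD i (false, 0)).2 := by
  induction P with
  | nil => simp
  | cons p P ih =>
    simp only [List.length_cons, Finset.sum_range_succ', List.map_cons, List.sum_cons,
      List.getD_cons_succ, List.getD_cons_zero, ih]
    ring

end Dih

/-- If `g = g₁⋯g_m·Δ^δ` is the Garside normal form of `g ∈ A_k` (so `m` is minimal),
`−m < δ < 0`, and `J` picks `|δ|` of the `gᵢ` of maximal possible length, then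
`|g|_S = Σ_{i∈J}(k − |gᵢ|_S) + Σ_{i∉J}|gᵢ|_S`. -/
theorem length_of_garside_mildly_negative (k : ℕ) (hk : 3 ≤ k) (g : Ak k)
    (L : List (Ak k)) (δ : ℤ)
    (hT : ∀ x ∈ L, x ∈ TsetA k)
    (hg : g = L.prod * ΔA k ^ δ)
    (hmin : ∀ (L' : List (Ak k)) (δ' : ℤ), (∀ x ∈ L', x ∈ TsetA k) →
      g = L'.prod * ΔA k ^ δ' → L.length ≤ L'.length)
    (hδneg : δ < 0) (hδm : -(L.length : ℤ) < δ)
    (J : Finset ℕ) (hJ : J ⊆ Finset.range L.length) (hJcard : J.card = δ.natAbs)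
    (hJmax : ∀ i ∈ J, ∀ j ∈ Finset.range L.length, j ∉ J →
      lenS k (L.getD j 1) ≤ lenS k (L.getD i 1)) :
    lenS k g = (∑ i ∈ J, (k - lenS k (L.getD i 1))) +
      ∑ i ∈ Finset.range L.length \ J, lenS k (L.getD i 1) := by
  obtain ⟨P, hP, rfl⟩ := Dih.exists_list k L hT
  rw [List.length_map] at *
  set l : ℕ → ℕ := fun i => (P.getD i (false, 0)).2 with hl
  have hPi : ∀ i < P.length, 1 ≤ l i ∧ l i < k := by
    intro i hi
    simp only [hl, List.getD_eq_getElem _ _ hi]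
    exact hP _ (List.getElem_mem hi)
  have hlen : ∀ i < P.length, lenS k ((P.map (Dih.el k)).getD i 1) = l i := by
    intro i hi
    rw [List.getD_eq_getElem _ _ (by simpa using hi), List.getElem_map,
      Dih.len_el k hk _ (hP _ (List.getElem_mem hi))]
    simp only [hl, List.getD_eq_getElem _ _ hi]
  have hJlt : ∀ i ∈ J, i < P.length := fun i hi => Finset.mem_range.1 (hJ hi)
  have e1 : (∑ i ∈ J, (k - lenS k ((P.map (Dih.el k)).getD i 1))) = ∑ i ∈ J, (k - l i) :=
    Finset.sum_congr rfl fun i hi => by rw [hlen i (hJlt i hi)]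
  have e2 : (∑ i ∈ Finset.range P.length \ J, lenS k ((P.map (Dih.el k)).getD i 1)) =
      ∑ i ∈ Finset.range P.length \ J, l i :=
    Finset.sum_congr rfl fun i hi => by
      rw [hlen i (Finset.mem_range.1 (Finset.mem_sdiff.1 hi).1)]
  rw [e1, e2]
  have hδ : δ = -(J.card : ℤ) := by omega
  have hrep : Dih.Rep k g ((∑ i ∈ J, (k - l i)) + ∑ i ∈ Finset.range P.length \ J, l i) := by
    have h := Dih.upper k P hP (fun i => decide (i ∈ J))
    simp only [decide_eq_true_eq] at h
    have s1 : (∑ i ∈ Finset.range P.length, if i ∈ J then (1 : ℤ) else 0) = J.card := by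
      rw [Finset.sum_ite_mem, Finset.inter_eq_right.2 hJ]; simp
    have s2 : (∑ i ∈ Finset.range P.length,
        if i ∈ J then k - (P.getD i (false, 0)).2 else (P.getD i (false, 0)).2) =
        (∑ i ∈ J, (k - l i)) + ∑ i ∈ Finset.range P.length \ J, l i := by
      rw [← Finset.sum_sdiff hJ, add_comm]
      congr 1
      · exact Finset.sum_congr rfl fun i hi => by rw [if_pos hi]
      · exact Finset.sum_congr rfl fun i hi => by rw [if_neg (Finset.mem_sdiff.1 hi).2]
    rw [s1, s2, ← hδ, ← hg] at h
    exact h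
  apply le_antisymm (Dih.len_le _ _ _ hrep)
  have hlow := Dih.le_len k hk g _ hrep
  have hchain := Dih.chain_of_min k hk P hP g δ hg hmin
  have hst := Dih.run_nf k hk P hP hchain (Dih.base k) rfl (by simp [Dih.base, Dih.topOK])
  rw [hg, Dih.ac_mul, Dih.ac_Dz, hst, ← hg] at hlow
  simp only [Dih.base, List.append_nil, zero_add] at hlow
  have hJne : J.Nonempty := by
    rw [← Finset.card_pos]; omega
  obtain ⟨i0, hi0, hi0min⟩ := Finset.exists_min_image J l hJne
  have hb := hPi i0 (hJlt i0 hi0)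
  have hdual := Dih.cst_dual k (l i0) (by positivity) (by exact_mod_cast hb.2.le)
    (P.map (fun p => (Dih.lst p, p.2))).reverse δ
  rw [List.map_reverse, List.sum_reverse, List.map_map] at hdual
  have hs := Dih.sum_getD P (fun n => min (n : ℤ) (2 * (l i0 : ℤ) - n))
  have hs' : (P.map ((fun p : Bool × ℕ => min (p.2 : ℤ) (2 * (l i0 : ℤ) - p.2)) ∘
      fun p => (Dih.lst p, p.2))).sum = _ := hs
  rw [hs', ← Finset.sum_sdiff hJ] at hdual
  have t1 : ∑ i ∈ Finset.range P.length \ J, min (l i : ℤ) (2 * (l i0 : ℤ) - l i) =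
      ∑ i ∈ Finset.range P.length \ J, (l i : ℤ) := by
    refine Finset.sum_congr rfl fun i hi => ?_
    obtain ⟨ha, hc⟩ := Finset.mem_sdiff.1 hi
    have := hJmax i0 hi0 i ha hc
    rw [hlen i (Finset.mem_range.1 ha), hlen i0 (hJlt i0 hi0)] at this
    omega
  have t2 : ∑ i ∈ J, min (l i : ℤ) (2 * (l i0 : ℤ) - l i) =
      ∑ i ∈ J, ((k - l i : ℕ) : ℤ) + J.card * (2 * (l i0 : ℤ) - k) := by
    rw [← nsmul_eq_mul, ← Finset.sum_const, ← Finset.sum_add_distrib]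
    refine Finset.sum_congr rfl fun i hi => ?_
    have := hi0min i hi
    have := hPi i (hJlt i hi)
    omega
  simp only [hl] at t1 t2 hdual hlow ⊢
  rw [t1, t2] at hdual
  zify
  have t3 : (2 * ((P.getD i0 (false, 0)).2 : ℤ) - k) * δ =
      - (J.card * (2 * ((P.getD i0 (false, 0)).2 : ℤ) - k)) := by rw [hδ]; ring
  rw [t3] at hdual
  linarith
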